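/- Under the PS&W setup, suppose g̃ : (0,∞) → [0,∞) is a measurable probability density (∫₀^∞ g̃(w) dw = 1). Then there exist constants C > 0 and ξ > 0 such that for all w ∈ (0,∞)ⁿ and all β ∈ ℝ^p: ( π(β | w, y) / π(β | y) )² ≤ C · ( ∑_{i=1}^n w_i + 1 )^p · exp( (ξ/2) ∑_{i=1}^n |u_iᵀβ| ). -/

import Mathlib

open Matrix MeasureTheory
open scoped ENNReal

/-- The precision matrix `UᵀΩ(w)U + B⁻¹` of the conditional Gaussian in the PS&W sampler. -/
noncomputable def pswPrec {n p : ℕ} (U : Matrix (Fin n) (Fin p) ℝ)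
    (B : Matrix (Fin p) (Fin p) ℝ) (w : Fin n → ℝ) : Matrix (Fin p) (Fin p) ℝ :=
  Uᵀ * Matrix.diagonal w * U + B⁻¹

/-- The vector `μ = Uᵀ(y − ½1ₙ) + B⁻¹b` in the PS&W setup. -/
noncomputable def pswMu {n p : ℕ} (U : Matrix (Fin n) (Fin p) ℝ)
    (B : Matrix (Fin p) (Fin p) ℝ) (b : Fin p → ℝ) (y : Fin n → ℝ) : Fin p → ℝ :=
  Uᵀ *ᵥ (fun i => y i - 1/2) + B⁻¹ *ᵥ b

/-- The `N_p(Σ(w)μ, Σ(w))` density `π(β | w, y)` of the PS&W Gibbs sampler. -/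
noncomputable def pswNormalDensity {n p : ℕ} (U : Matrix (Fin n) (Fin p) ℝ)
    (B : Matrix (Fin p) (Fin p) ℝ) (b : Fin p → ℝ) (y : Fin n → ℝ)
    (β : Fin p → ℝ) (w : Fin n → ℝ) : ℝ :=
  (2 * Real.pi) ^ (-(p : ℝ) / 2) * (pswPrec U B w).det ^ ((1 : ℝ) / 2) *
    Real.exp (-(1/2) * ((β - (pswPrec U B w)⁻¹ *ᵥ pswMu U B b y) ⬝ᵥ
      (pswPrec U B w) *ᵥ (β - (pswPrec U B w)⁻¹ *ᵥ pswMu U B b y)))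

/-- The standard logistic distribution function `F(t) = eᵗ/(1+eᵗ)`. -/
noncomputable def logisticF (t : ℝ) : ℝ := Real.exp t / (1 + Real.exp t)

/-- The `N_p(b, B)` prior density for `β`. -/
noncomputable def pswPrior {p : ℕ} (B : Matrix (Fin p) (Fin p) ℝ) (b : Fin p → ℝ)
    (β : Fin p → ℝ) : ℝ :=
  (2 * Real.pi) ^ (-(p : ℝ) / 2) * B.det ^ (-(1 : ℝ) / 2) *
    Real.exp (-(1/2) * ((β - b) ⬝ᵥ B⁻¹ *ᵥ (β - b)))

/-- The logistic regression likelihood `∏ᵢ F(uᵢᵀβ)^{yᵢ} (1 − F(uᵢᵀβ))^{1−yᵢ}`. -/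
noncomputable def pswLik {n p : ℕ} (U : Matrix (Fin n) (Fin p) ℝ) (y : Fin n → ℝ)
    (β : Fin p → ℝ) : ℝ :=
  ∏ i, (logisticF ((U *ᵥ β) i)) ^ (y i) * (1 - logisticF ((U *ᵥ β) i)) ^ (1 - y i)

/-- Expansion of a shifted quadratic form of a symmetric matrix. -/
lemma Matrix.IsSymm.sub_dotProduct_mulVec_sub {ι : Type*} [Fintype ι] {A : Matrix ι ι ℝ}
    (hA : A.IsSymm) (x v : ι → ℝ) :
    (x - v) ⬝ᵥ A *ᵥ (x - v) = x ⬝ᵥ A *ᵥ x - 2 * (x ⬝ᵥ A *ᵥ v) + v ⬝ᵥ A *ᵥ v := by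
  have h : v ⬝ᵥ A *ᵥ x = x ⬝ᵥ A *ᵥ v := by
    rw [dotProduct_mulVec, ← mulVec_transpose, hA.eq, dotProduct_comm]
  rw [mulVec_sub, sub_dotProduct, dotProduct_sub, dotProduct_sub, h]
  ring

/-- The weighted Gram form is a weighted sum of squares. -/
lemma dotProduct_gram_mulVec {n p : ℕ} (U : Matrix (Fin n) (Fin p) ℝ) (w : Fin n → ℝ)
    (x : Fin p → ℝ) :
    x ⬝ᵥ (Uᵀ * diagonal w * U) *ᵥ x = ∑ i, w i * (U *ᵥ x) i ^ 2 := by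
  rw [← mulVec_mulVec, ← mulVec_mulVec, mulVec_transpose, dotProduct_comm,
    ← dotProduct_mulVec, dotProduct]
  refine Finset.sum_congr rfl fun i _ => ?_
  rw [mulVec_diagonal]
  ring

lemma pswPrec_posDef {n p : ℕ} (U : Matrix (Fin n) (Fin p) ℝ) {B : Matrix (Fin p) (Fin p) ℝ}
    (hB : B.PosDef) {w : Fin n → ℝ} (hw : ∀ i, 0 ≤ w i) : (pswPrec U B w).PosDef := by
  have h : (Uᵀ * diagonal w * U).PosSemidef := by
    simpa [conjTranspose_eq_transpose_of_trivial] using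
      (PosSemidef.diagonal (d := w) hw).conjTranspose_mul_mul_same U
  exact Matrix.PosDef.posSemidef_add h hB.inv

/-- The determinant of the precision matrix grows at most like the `p`-th power of the weights. -/
lemma exists_det_pswPrec_le {n p : ℕ} (U : Matrix (Fin n) (Fin p) ℝ)
    (B : Matrix (Fin p) (Fin p) ℝ) :
    ∃ K > (0 : ℝ), ∀ w : Fin n → ℝ, (∀ i, 0 ≤ w i) →
      (pswPrec U B w).det ≤ K * (∑ i, w i + 1) ^ p := by
  obtain ⟨M, hM⟩ := (Set.finite_range fun q : Fin n × Fin p × Fin p =>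
    |U q.1 q.2.1 * U q.1 q.2.2|).bddAbove
  obtain ⟨N, hN⟩ := (Set.finite_range fun q : Fin p × Fin p => |B⁻¹ q.1 q.2|).bddAbove
  have hU : ∀ i j k, |U i j * U i k| ≤ max M N ⊔ 1 := fun i j k =>
    (hM ⟨(i, j, k), rfl⟩).trans ((le_max_left _ _).trans (le_max_left _ _))
  have hBi : ∀ j k, |B⁻¹ j k| ≤ max M N ⊔ 1 := fun j k =>
    (hN ⟨(j, k), rfl⟩).trans ((le_max_right _ _).trans (le_max_left _ _))
  have hL : 0 < max M N ⊔ 1 := lt_of_lt_of_le one_pos (le_max_right _ _)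
  generalize max M N ⊔ 1 = L at hU hBi hL
  refine ⟨p.factorial * L ^ p, by positivity, fun w hw => ?_⟩
  have hentry : ∀ j k, |pswPrec U B w j k| ≤ L * (∑ i, w i + 1) := by
    intro j k
    have he : (Uᵀ * diagonal w * U) j k = ∑ i, w i * (U i j * U i k) := by
      rw [mul_apply]
      refine Finset.sum_congr rfl fun i _ => ?_
      rw [mul_diagonal, transpose_apply]
      ring
    have hs : |∑ i, w i * (U i j * U i k)| ≤ ∑ i, w i * L := by
      refine (Finset.abs_sum_le_sum_abs _ _).trans (Finset.sum_le_sum fun i _ => ?_)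
      rw [abs_mul, abs_of_nonneg (hw i)]
      exact mul_le_mul_of_nonneg_left (hU i j k) (hw i)
    rw [pswPrec, Matrix.add_apply, he]
    refine (abs_add_le _ _).trans ((add_le_add hs (hBi j k)).trans_eq ?_)
    rw [← Finset.sum_mul]
    ring
  have hdet := det_le (A := pswPrec U B w) (abv := AbsoluteValue.abs) hentry
  simp only [AbsoluteValue.abs_apply, Fintype.card_fin, nsmul_eq_mul, mul_pow] at hdet
  calc (pswPrec U B w).det ≤ _ := le_abs_self _
    _ ≤ _ := hdet
    _ = _ := by ring

/-- Dropping nonnegative terms from the exponent of the conditional Gaussian density. -/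
lemma pswNormalDensity_le {n p : ℕ} (U : Matrix (Fin n) (Fin p) ℝ)
    {B : Matrix (Fin p) (Fin p) ℝ} (hB : B.PosDef) (b : Fin p → ℝ) (y : Fin n → ℝ)
    (β : Fin p → ℝ) {w : Fin n → ℝ} (hw : ∀ i, 0 ≤ w i) :
    pswNormalDensity U B b y β w ≤
      pswPrior B b β * (B.det ^ ((1 : ℝ) / 2) * (pswPrec U B w).det ^ ((1 : ℝ) / 2) *
        Real.exp (1 / 2 * (b ⬝ᵥ B⁻¹ *ᵥ b)) *
        Real.exp (∑ i, (y i - 1 / 2) * (U *ᵥ β) i)) := by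
  have hP := pswPrec_posDef U hB hw
  have hPs : (pswPrec U B w).IsSymm := by
    simpa [IsHermitian, IsSymm, conjTranspose_eq_transpose_of_trivial] using hP.isHermitian
  have hBs : (B⁻¹).IsSymm := by
    simpa [IsHermitian, IsSymm, conjTranspose_eq_transpose_of_trivial] using hB.inv.isHermitian
  have hv : pswPrec U B w *ᵥ ((pswPrec U B w)⁻¹ *ᵥ pswMu U B b y) = pswMu U B b y := by
    rw [mulVec_mulVec, mul_nonsing_inv _ hP.det_pos.ne'.isUnit, one_mulVec]
  have hvnonneg : 0 ≤ ((pswPrec U B w)⁻¹ *ᵥ pswMu U B b y) ⬝ᵥ pswPrec U B w *ᵥ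
      ((pswPrec U B w)⁻¹ *ᵥ pswMu U B b y) := by
    simpa using hP.posSemidef.dotProduct_mulVec_nonneg ((pswPrec U B w)⁻¹ *ᵥ pswMu U B b y)
  have hquad : β ⬝ᵥ B⁻¹ *ᵥ β ≤ β ⬝ᵥ pswPrec U B w *ᵥ β := by
    rw [pswPrec, add_mulVec, dotProduct_add, dotProduct_gram_mulVec]
    have : 0 ≤ ∑ i, w i * (U *ᵥ β) i ^ 2 :=
      Finset.sum_nonneg fun i _ => mul_nonneg (hw i) (sq_nonneg _)
    linarith
  have hmu : β ⬝ᵥ pswMu U B b y =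
      ∑ i, (y i - 1 / 2) * (U *ᵥ β) i + β ⬝ᵥ B⁻¹ *ᵥ b := by
    rw [pswMu, dotProduct_add, mulVec_transpose, dotProduct_comm, ← dotProduct_mulVec]
    rfl
  have hdet : B.det ^ (-(1 : ℝ) / 2) * B.det ^ ((1 : ℝ) / 2) = 1 := by
    rw [← Real.rpow_add hB.det_pos]
    norm_num
  have hexp : Real.exp (-(1/2) * ((β - (pswPrec U B w)⁻¹ *ᵥ pswMu U B b y) ⬝ᵥ
      (pswPrec U B w) *ᵥ (β - (pswPrec U B w)⁻¹ *ᵥ pswMu U B b y))) ≤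
      Real.exp (-(1/2) * ((β - b) ⬝ᵥ B⁻¹ *ᵥ (β - b))) *
        Real.exp (1 / 2 * (b ⬝ᵥ B⁻¹ *ᵥ b)) *
        Real.exp (∑ i, (y i - 1 / 2) * (U *ᵥ β) i) := by
    rw [← Real.exp_add, ← Real.exp_add, Real.exp_le_exp, hPs.sub_dotProduct_mulVec_sub,
      hBs.sub_dotProduct_mulVec_sub]
    rw [hv] at hvnonneg ⊢
    linarith
  have hK : 0 ≤ (2 * Real.pi) ^ (-(p : ℝ) / 2) * (pswPrec U B w).det ^ ((1 : ℝ) / 2) :=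
    mul_nonneg (by positivity) (Real.rpow_nonneg hP.det_pos.le _)
  refine (mul_le_mul_of_nonneg_left hexp hK).trans_eq ?_
  rw [pswPrior]
  linear_combination (-((2 * Real.pi) ^ (-(p : ℝ) / 2) * (pswPrec U B w).det ^ ((1 : ℝ) / 2) *
    Real.exp (-(1/2) * ((β - b) ⬝ᵥ B⁻¹ *ᵥ (β - b))) *
    Real.exp (1 / 2 * (b ⬝ᵥ B⁻¹ *ᵥ b)) *
    Real.exp (∑ i, (y i - 1 / 2) * (U *ᵥ β) i))) * hdet

lemma logisticF_pos (t : ℝ) : 0 < logisticF t := by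
  unfold logisticF
  positivity

lemma one_sub_logisticF (t : ℝ) : 1 - logisticF t = 1 / (1 + Real.exp t) := by
  have : 1 + Real.exp t ≠ 0 := by positivity
  unfold logisticF
  field_simp
  ring

lemma pswLik_pos {n p : ℕ} (U : Matrix (Fin n) (Fin p) ℝ) (y : Fin n → ℝ) (β : Fin p → ℝ) :
    0 < pswLik U y β := by
  refine Finset.prod_pos fun i _ => mul_pos (Real.rpow_pos_of_pos (logisticF_pos _) _)
    (Real.rpow_pos_of_pos ?_ _)
  rw [one_sub_logisticF]
  positivity

lemma one_add_exp_le (t : ℝ) : 1 + Real.exp t ≤ 2 * Real.exp (|t| / 2) * Real.exp (t / 2) := by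
  have h1 : 1 ≤ Real.exp (|t| / 2 + t / 2) := Real.one_le_exp (by linarith [neg_abs_le t])
  have h2 : Real.exp t ≤ Real.exp (|t| / 2 + t / 2) :=
    Real.exp_le_exp.2 (by linarith [le_abs_self t])
  rw [mul_assoc, ← Real.exp_add]
  linarith

lemma exp_le_logistic_lik {y : ℝ} (hy : y = 0 ∨ y = 1) (t : ℝ) :
    Real.exp ((y - 1 / 2) * t) ≤
      2 * Real.exp (|t| / 2) * (logisticF t ^ y * (1 - logisticF t) ^ (1 - y)) := by
  have hpos : 0 < 1 + Real.exp t := by positivity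
  have h := one_add_exp_le t
  have key : logisticF t ^ y * (1 - logisticF t) ^ (1 - y) =
      Real.exp (y * t) / (1 + Real.exp t) := by
    rw [one_sub_logisticF]
    rcases hy with rfl | rfl <;> simp [logisticF]
  have hsplit : Real.exp ((y - 1 / 2) * t) * Real.exp (t / 2) = Real.exp (y * t) := by
    rw [← Real.exp_add]
    ring_nf
  rw [key, ← mul_div_assoc, le_div_iff₀ hpos, ← hsplit]
  calc Real.exp ((y - 1 / 2) * t) * (1 + Real.exp t)
      ≤ Real.exp ((y - 1 / 2) * t) * (2 * Real.exp (|t| / 2) * Real.exp (t / 2)) := by gcongr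
    _ = _ := by ring

lemma exp_le_pswLik {n p : ℕ} (U : Matrix (Fin n) (Fin p) ℝ) {y : Fin n → ℝ}
    (hy : ∀ i, y i = 0 ∨ y i = 1) (β : Fin p → ℝ) :
    Real.exp (∑ i, (y i - 1 / 2) * (U *ᵥ β) i) ≤
      2 ^ n * Real.exp (1 / 2 * ∑ i, |(U *ᵥ β) i|) * pswLik U y β := by
  have hprod : (2 : ℝ) ^ n * Real.exp (1 / 2 * ∑ i, |(U *ᵥ β) i|) =
      ∏ i, 2 * Real.exp (|(U *ᵥ β) i| / 2) := by
    rw [Finset.prod_mul_distrib, ← Real.exp_sum, ← Finset.sum_div]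
    simp only [Finset.prod_const, Finset.card_univ, Fintype.card_fin]
    ring_nf
  rw [hprod, pswLik, ← Finset.prod_mul_distrib, Real.exp_sum]
  exact Finset.prod_le_prod (fun i _ => (Real.exp_pos _).le)
    fun i _ => exp_le_logistic_lik (hy i) _

/-- Bound (29) in the proof of Theorem 5: the squared ratio of the conditional Gaussian density
`π(β | w, y)` to the posterior density `π(β | y)` is dominated by
`C (∑ᵢ wᵢ + 1)^p exp((ξ/2) ∑ᵢ |uᵢᵀβ|)`. -/
theorem stmt_12 {n p : ℕ} (hn : 0 < n) (hp : 0 < p)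
    (U : Matrix (Fin n) (Fin p) ℝ) (B : Matrix (Fin p) (Fin p) ℝ) (hB : B.PosDef)
    (b : Fin p → ℝ) (y : Fin n → ℝ) (hy : ∀ i, y i = 0 ∨ y i = 1)
    (gt : ℝ → ℝ) (hgt_meas : Measurable gt) (hgt_nonneg : ∀ w, 0 < w → 0 ≤ gt w)
    (hgt_prob : ∫⁻ w in Set.Ioi (0 : ℝ), ENNReal.ofReal (gt w) = 1)
    (c : ℝ)
    (hc_int : Integrable (fun β : Fin p → ℝ => pswPrior B b β * pswLik U y β)
      (volume : Measure (Fin p → ℝ)))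
    (hc_def : c = ∫ β : Fin p → ℝ, pswPrior B b β * pswLik U y β ∂volume)
    (hc_pos : 0 < c) :
    ∃ C > (0 : ℝ), ∃ ξ > (0 : ℝ), ∀ w : Fin n → ℝ, (∀ i, 0 < w i) → ∀ β : Fin p → ℝ,
      (pswNormalDensity U B b y β w / (pswPrior B b β * pswLik U y β / c)) ^ 2
        ≤ C * (∑ i, w i + 1) ^ (p : ℕ) * Real.exp ((ξ / 2) * ∑ i, |(U *ᵥ β) i|) := by
  obtain ⟨K, hK, hdet⟩ := exists_det_pswPrec_le U B
  have hBdet := hB.det_pos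
  refine ⟨c ^ 2 * B.det * Real.exp (b ⬝ᵥ B⁻¹ *ᵥ b) * 4 ^ n * K, by positivity, 2, two_pos,
    fun w hw β => ?_⟩
  have hw' : ∀ i, 0 ≤ w i := fun i => (hw i).le
  have hPdet := (pswPrec_posDef U hB hw').det_pos
  have hprior : 0 < pswPrior B b β := by
    have := Real.rpow_pos_of_pos hBdet (-(1 : ℝ) / 2)
    unfold pswPrior
    positivity
  have hlik := pswLik_pos U y β
  have hdens : 0 ≤ pswNormalDensity U B b y β w := by
    have := Real.rpow_pos_of_pos hPdet ((1 : ℝ) / 2)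
    unfold pswNormalDensity
    positivity
  have hratio : pswNormalDensity U B b y β w / (pswPrior B b β * pswLik U y β / c) ≤
      c * (B.det ^ ((1 : ℝ) / 2) * (pswPrec U B w).det ^ ((1 : ℝ) / 2) *
        Real.exp (1 / 2 * (b ⬝ᵥ B⁻¹ *ᵥ b)) *
        (2 ^ n * Real.exp (1 / 2 * ∑ i, |(U *ᵥ β) i|))) := by
    rw [div_le_iff₀ (by positivity)]
    refine (pswNormalDensity_le U hB b y β hw').trans ?_
    calc _ ≤ pswPrior B b β * (B.det ^ ((1 : ℝ) / 2) * (pswPrec U B w).det ^ ((1 : ℝ) / 2) *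
        Real.exp (1 / 2 * (b ⬝ᵥ B⁻¹ *ᵥ b)) *
        (2 ^ n * Real.exp (1 / 2 * ∑ i, |(U *ᵥ β) i|) * pswLik U y β)) := by
          gcongr
          exact exp_le_pswLik U hy β
      _ = _ := by field_simp
  have hsqrt : ∀ x : ℝ, 0 < x → (x ^ ((1 : ℝ) / 2)) ^ 2 = x := fun x hx => by
    rw [← Real.sqrt_eq_rpow, Real.sq_sqrt hx.le]
  have hexp : ∀ x : ℝ, Real.exp (1 / 2 * x) ^ 2 = Real.exp x := fun x => by
    rw [← Real.exp_nat_mul]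
    congr 1
    push_cast
    ring
  have h4 : ((2 : ℝ) ^ n) ^ 2 = 4 ^ n := by
    rw [← pow_mul, mul_comm, pow_mul]
    norm_num
  refine (pow_le_pow_left₀ (by positivity) hratio 2).trans ?_
  simp only [mul_pow, hsqrt _ hBdet, hsqrt _ hPdet, hexp, h4]
  calc _ = c ^ 2 * B.det * Real.exp (b ⬝ᵥ B⁻¹ *ᵥ b) * 4 ^ n *
        Real.exp (∑ i, |(U *ᵥ β) i|) * (pswPrec U B w).det := by ring
    _ ≤ c ^ 2 * B.det * Real.exp (b ⬝ᵥ B⁻¹ *ᵥ b) * 4 ^ n *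
        Real.exp (∑ i, |(U *ᵥ β) i|) * (K * (∑ i, w i + 1) ^ p) := by
          gcongr
          exact hdet w hw'
    _ = _ := by
          rw [div_self two_ne_zero, one_mul]
          ring
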